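/- Let n ≥ 1 and let A be an elasticity Z-tensor. The following are equivalent: (1) A is a nonsingular elasticity M-tensor; (2) for every nonzero y ∈ ℝ^n with y ≥ 0 the symmetric Z-matrix A y² is positive definite (i.e. a nonsingular M-matrix); (3) for every nonzero y ∈ ℝ^n with y ≥ 0 there exists x ∈ ℝ^n with x > 0 such that the vector A x y² is componentwise positive; (4) for every nonzero y ∈ ℝ^n with y ≥ 0 there exists x ∈ ℝ^n with x ≥ 0 such that the vector A x y² is componentwise positive. -/

import Mathlib

open Finset

noncomputable section

/-- Symmetry condition of an elasticity tensor: `a_{ijkl} = a_{jikl} = a_{ijlk}`. -/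
def ElastSym {n : ℕ} (A : Fin n → Fin n → Fin n → Fin n → ℝ) : Prop :=
  ∀ i j k l, A i j k l = A j i k l ∧ A i j k l = A i j l k

/-- The scalar `A x² y² = ∑ a_{ijkl} x_i x_j y_k y_l`. -/
def tQuad {n : ℕ} (A : Fin n → Fin n → Fin n → Fin n → ℝ) (x y : Fin n → ℝ) : ℝ :=
  ∑ i, ∑ j, ∑ k, ∑ l, A i j k l * x i * x j * y k * y l

/-- The vector `(A x y²)_i = ∑ a_{ijkl} x_j y_k y_l`. -/
def tAxyy {n : ℕ} (A : Fin n → Fin n → Fin n → Fin n → ℝ) (x y : Fin n → ℝ) : Fin n → ℝ :=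
  fun i => ∑ j, ∑ k, ∑ l, A i j k l * x j * y k * y l

/-- The vector `(A x² y)_l = ∑ a_{ijkl} x_i x_j y_k`. -/
def tAxxy {n : ℕ} (A : Fin n → Fin n → Fin n → Fin n → ℝ) (x y : Fin n → ℝ) : Fin n → ℝ :=
  fun l => ∑ i, ∑ j, ∑ k, A i j k l * x i * x j * y k

/-- The matrix `(A x²)_{kl} = ∑ a_{ijkl} x_i x_j`. -/
def matAx2 {n : ℕ} (A : Fin n → Fin n → Fin n → Fin n → ℝ) (x : Fin n → ℝ) :
    Matrix (Fin n) (Fin n) ℝ :=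
  Matrix.of fun k l => ∑ i, ∑ j, A i j k l * x i * x j

/-- The matrix `(A y²)_{ij} = ∑ a_{ijkl} y_k y_l`. -/
def matAy2 {n : ℕ} (A : Fin n → Fin n → Fin n → Fin n → ℝ) (y : Fin n → ℝ) :
    Matrix (Fin n) (Fin n) ℝ :=
  Matrix.of fun i j => ∑ k, ∑ l, A i j k l * y k * y l

/-- The identity tensor `e_{ijkl} = 1` iff `i = j` and `k = l`. -/
def idT (n : ℕ) : Fin n → Fin n → Fin n → Fin n → ℝ :=
  fun i j k l => if i = j ∧ k = l then 1 else 0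

/-- `xᵀ x = 1`. -/
def unitVec {n : ℕ} (x : Fin n → ℝ) : Prop := ∑ i, x i * x i = 1

/-- `(λ, x, y)` is an M-eigenpair of `A`. -/
def IsMEig {n : ℕ} (A : Fin n → Fin n → Fin n → Fin n → ℝ) (lam : ℝ) (x y : Fin n → ℝ) :
    Prop :=
  (∀ i, tAxyy A x y i = lam * x i) ∧ (∀ l, tAxxy A x y l = lam * y l) ∧
    unitVec x ∧ unitVec y

/-- M-positive definiteness (the strong ellipticity condition). -/
def MPD {n : ℕ} (A : Fin n → Fin n → Fin n → Fin n → ℝ) : Prop :=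
  ∀ x y : Fin n → ℝ, x ≠ 0 → y ≠ 0 → 0 < tQuad A x y

/-- M-positive semidefiniteness. -/
def MPSD {n : ℕ} (A : Fin n → Fin n → Fin n → Fin n → ℝ) : Prop :=
  ∀ x y : Fin n → ℝ, 0 ≤ tQuad A x y

/-- All entries are nonnegative. -/
def NonnegT {n : ℕ} (A : Fin n → Fin n → Fin n → Fin n → ℝ) : Prop :=
  ∀ i j k l, 0 ≤ A i j k l

/-- The M-spectral radius of a nonnegative elasticity tensor:
`sup { B x² y² : xᵀx = yᵀy = 1 }`. -/
def rhoM {n : ℕ} (B : Fin n → Fin n → Fin n → Fin n → ℝ) : ℝ :=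
  sSup { r : ℝ | ∃ x y : Fin n → ℝ, unitVec x ∧ unitVec y ∧ r = tQuad B x y }

/-- An elasticity Z-tensor: all off-diagonal entries nonpositive. -/
def ZTensor {n : ℕ} (A : Fin n → Fin n → Fin n → Fin n → ℝ) : Prop :=
  ∀ i j k l, ¬(i = j ∧ k = l) → A i j k l ≤ 0

/-- A nonsingular elasticity M-tensor: `A = s E - B` with `B` nonnegative and `s > ρ_M(B)`. -/
def NonsingMT {n : ℕ} (A : Fin n → Fin n → Fin n → Fin n → ℝ) : Prop :=
  ∃ (s : ℝ) (B : Fin n → Fin n → Fin n → Fin n → ℝ),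
    ElastSym B ∧ NonnegT B ∧ (∀ i j k l, A i j k l = s * idT n i j k l - B i j k l) ∧
      rhoM B < s

/-- An elasticity M-tensor: `A = s E - B` with `B` nonnegative and `s ≥ ρ_M(B)`. -/
def ElastMT {n : ℕ} (A : Fin n → Fin n → Fin n → Fin n → ℝ) : Prop :=
  ∃ (s : ℝ) (B : Fin n → Fin n → Fin n → Fin n → ℝ),
    ElastSym B ∧ NonnegT B ∧ (∀ i j k l, A i j k l = s * idT n i j k l - B i j k l) ∧
      rhoM B ≤ s

/-- Irreducibility of a (nonnegative) square matrix. -/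
def MatIrred {n : ℕ} (M : Matrix (Fin n) (Fin n) ℝ) : Prop :=
  ∀ S : Finset (Fin n), S.Nonempty → S ≠ Finset.univ → ∃ k ∈ S, ∃ l ∉ S, M k l ≠ 0

/-- Strict diagonal dominance. -/
def SDD {n : ℕ} (M : Matrix (Fin n) (Fin n) ℝ) : Prop :=
  ∀ i, ∑ j ∈ Finset.univ.erase i, |M i j| < |M i i|

open Matrix

lemma matAy2_isHermitian {n : ℕ} {A : Fin n → Fin n → Fin n → Fin n → ℝ} (hA : ElastSym A)
    (y : Fin n → ℝ) : (matAy2 A y).IsHermitian := by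
  ext i j
  simp only [conjTranspose_apply, matAy2, of_apply, star_trivial]
  exact sum_congr rfl fun k _ => sum_congr rfl fun l _ => by rw [(hA i j k l).1]

lemma matAy2_apply_nonpos {n : ℕ} {A : Fin n → Fin n → Fin n → Fin n → ℝ} (hZ : ZTensor A)
    {y : Fin n → ℝ} (hy : ∀ i, 0 ≤ y i) {i j : Fin n} (hij : i ≠ j) : matAy2 A y i j ≤ 0 := by
  simp only [matAy2, of_apply]
  refine sum_nonpos fun k _ => sum_nonpos fun l _ => ?_
  rw [mul_assoc]
  exact mul_nonpos_of_nonpos_of_nonneg (hZ i j k l fun h => hij h.1)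
    (mul_nonneg (hy k) (hy l))

lemma tAxyy_eq_mulVec {n : ℕ} (A : Fin n → Fin n → Fin n → Fin n → ℝ) (x y : Fin n → ℝ) :
    tAxyy A x y = matAy2 A y *ᵥ x := by
  ext i
  simp only [tAxyy, mulVec, dotProduct, matAy2, of_apply, sum_mul]
  exact sum_congr rfl fun j _ => sum_congr rfl fun k _ => sum_congr rfl fun l _ => by ring

lemma tQuad_eq_dotProduct {n : ℕ} (A : Fin n → Fin n → Fin n → Fin n → ℝ) (x y : Fin n → ℝ) :
    tQuad A x y = x ⬝ᵥ (matAy2 A y *ᵥ x) := by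
  rw [← tAxyy_eq_mulVec]
  simp only [tQuad, tAxyy, dotProduct, mul_sum]
  exact sum_congr rfl fun i _ => sum_congr rfl fun j _ => sum_congr rfl fun k _ =>
    sum_congr rfl fun l _ => by ring

/-- A nonnegative vector mapped to a positive one by a Z-matrix is positive. -/
lemma pos_of_mulVec_pos {n : ℕ} {M : Matrix (Fin n) (Fin n) ℝ}
    (hM : ∀ i j, i ≠ j → M i j ≤ 0) {x : Fin n → ℝ} (hx : ∀ i, 0 ≤ x i)
    (hMx : ∀ i, 0 < (M *ᵥ x) i) (i : Fin n) : 0 < x i := by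
  refine (hx i).lt_of_ne' fun h => (hMx i).not_ge ?_
  rw [mulVec, dotProduct]
  refine sum_nonpos fun j _ => ?_
  rcases eq_or_ne i j with rfl | hij
  · simp [h]
  · exact mul_nonpos_of_nonpos_of_nonneg (hM i j hij) (hx j)

/-- A positive definite Z-matrix maps some positive vector to a positive vector. -/
lemma exists_pos_mulVec_pos_of_posDef {n : ℕ} {M : Matrix (Fin n) (Fin n) ℝ}
    (hM : ∀ i j, i ≠ j → M i j ≤ 0) (hpd : M.PosDef) :
    ∃ x : Fin n → ℝ, (∀ i, 0 < x i) ∧ ∀ i, 0 < (M *ᵥ x) i := by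
  have hdet : IsUnit M.det := hpd.det_pos.ne'.isUnit
  obtain ⟨x, hx⟩ : ∃ x, M *ᵥ x = fun _ => 1 :=
    ⟨M⁻¹ *ᵥ fun _ => 1, by rw [mulVec_mulVec, mul_nonsing_inv _ hdet, one_mulVec]⟩
  have hMx : ∀ i, 0 < (M *ᵥ x) i := fun i => by simp [hx]
  refine ⟨x, pos_of_mulVec_pos hM ?_ hMx, hMx⟩
  set u : Fin n → ℝ := fun i => max (-x i) 0 with hu
  have hle : u ⬝ᵥ (M *ᵥ x) + u ⬝ᵥ (M *ᵥ u) ≤ 0 := by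
    simp only [dotProduct, mulVec, mul_sum, ← sum_add_distrib]
    refine sum_nonpos fun i _ => sum_nonpos fun j _ => ?_
    have hui : 0 ≤ u i := le_max_right _ _
    have hxu : 0 ≤ x j + u j := by
      have : -x j ≤ u j := le_max_left _ _
      linarith
    have heq : u i * (M i j * x j) + u i * (M i j * u j) = M i j * (u i * (x j + u j)) := by ring
    rw [heq]
    rcases eq_or_ne i j with rfl | hij
    · rcases le_total (x i) 0 with h | h
      · simp [hu, h]
      · simp [hu, h]
    · exact mul_nonpos_of_nonpos_of_nonneg (hM i j hij) (mul_nonneg hui hxu)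
  have hpos : 0 ≤ u ⬝ᵥ (M *ᵥ x) :=
    sum_nonneg fun i _ => mul_nonneg (le_max_right _ _) (hMx i).le
  have hu0 : u = 0 := by
    by_contra h
    have := hpd.dotProduct_mulVec_pos h
    rw [star_trivial] at this
    linarith
  intro i
  have : -x i ≤ u i := le_max_left _ _
  rw [hu0, Pi.zero_apply] at this
  linarith

/-- A symmetric Z-matrix mapping some nonnegative vector to a positive one is positive definite. -/
lemma posDef_of_mulVec_pos {n : ℕ} {M : Matrix (Fin n) (Fin n) ℝ} (hsymm : M.IsHermitian)
    (hM : ∀ i j, i ≠ j → M i j ≤ 0) {x : Fin n → ℝ} (hx : ∀ i, 0 ≤ x i)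
    (hMx : ∀ i, 0 < (M *ᵥ x) i) : M.PosDef := by
  have hx' := pos_of_mulVec_pos hM hx hMx
  refine PosDef.of_dotProduct_mulVec_pos hsymm fun v hv => ?_
  rw [star_trivial]
  have hMs : ∀ i j, M i j = M j i := fun i j => by simpa using hsymm.apply j i
  set w : Fin n → ℝ := fun i => v i / x i with hw
  have hvw : ∀ i, v i = x i * w i := fun i => by
    rw [hw]; field_simp [(hx' i).ne']
  have hid : 2 * (v ⬝ᵥ (M *ᵥ v)) = 2 * ∑ i, (M *ᵥ x) i * (x i * w i ^ 2)
      + ∑ i, ∑ j, -M i j * (x i * x j * (w i - w j) ^ 2) := by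
    have hswap : ∑ i, ∑ j, M i j * x j * (x i * w i ^ 2)
        = ∑ i, ∑ j, M i j * x i * (x j * w j ^ 2) := by
      rw [sum_comm]
      exact sum_congr rfl fun i _ => sum_congr rfl fun j _ => by rw [hMs j i]
    have h2 : 2 * ∑ i, (M *ᵥ x) i * (x i * w i ^ 2)
        = ∑ i, ∑ j, M i j * x j * (x i * w i ^ 2)
          + ∑ i, ∑ j, M i j * x i * (x j * w j ^ 2) := by
      rw [← hswap, ← two_mul]
      simp only [mulVec, dotProduct, sum_mul]
    rw [h2]
    simp only [mulVec, dotProduct, mul_sum, ← sum_add_distrib]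
    refine sum_congr rfl fun i _ => sum_congr rfl fun j _ => ?_
    rw [hvw i, hvw j]
    ring
  have h1 : 0 < ∑ i, (M *ᵥ x) i * (x i * w i ^ 2) := by
    obtain ⟨i, hi⟩ := Function.ne_iff.mp hv
    have hwi : w i ≠ 0 := div_ne_zero hi (hx' i).ne'
    refine sum_pos' (fun j _ => ?_) ⟨i, mem_univ i, ?_⟩
    · exact mul_nonneg (hMx j).le (mul_nonneg (hx j) (sq_nonneg _))
    · exact mul_pos (hMx i) (mul_pos (hx' i) (by positivity))
  have h2 : 0 ≤ ∑ i, ∑ j, -M i j * (x i * x j * (w i - w j) ^ 2) := by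
    refine sum_nonneg fun i _ => sum_nonneg fun j _ => ?_
    rcases eq_or_ne i j with rfl | hij
    · simp
    · exact mul_nonneg (neg_nonneg.mpr (hM i j hij))
        (mul_nonneg (mul_nonneg (hx i) (hx j)) (sq_nonneg _))
  linarith

lemma isCompact_setOf_unitVec (n : ℕ) : IsCompact {x : Fin n → ℝ | unitVec x} := by
  refine (isCompact_Icc (a := fun _ : Fin n => (-1 : ℝ)) (b := fun _ => 1)).of_isClosed_subset
    ?_ fun x hx => ?_
  · exact isClosed_eq (by fun_prop) continuous_const
  · have h : ∀ i, x i * x i ≤ 1 := fun i => by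
      rw [← show ∑ i, x i * x i = 1 from hx]
      exact single_le_sum (f := fun i => x i * x i) (fun j _ => mul_self_nonneg (x j)) (mem_univ i)
    exact ⟨fun i => (by nlinarith [h i] : -1 ≤ x i), fun i => (by nlinarith [h i] : x i ≤ 1)⟩

lemma continuous_tQuad {n : ℕ} (A : Fin n → Fin n → Fin n → Fin n → ℝ) :
    Continuous fun p : (Fin n → ℝ) × (Fin n → ℝ) => tQuad A p.1 p.2 := by
  unfold tQuad
  fun_prop

lemma tQuad_le_rhoM {n : ℕ} (B : Fin n → Fin n → Fin n → Fin n → ℝ) {x y : Fin n → ℝ}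
    (hx : unitVec x) (hy : unitVec y) : tQuad B x y ≤ rhoM B := by
  refine le_csSup ?_ ⟨x, y, hx, hy, rfl⟩
  refine (((isCompact_setOf_unitVec n).prod (isCompact_setOf_unitVec n)).image
    (continuous_tQuad B)).bddAbove.mono ?_
  rintro r ⟨x, y, hx, hy, rfl⟩
  exact ⟨(x, y), ⟨hx, hy⟩, rfl⟩

lemma unitVec.ne_zero {n : ℕ} {x : Fin n → ℝ} (hx : unitVec x) : x ≠ 0 := by
  rintro rfl
  simp [unitVec] at hx

lemma exists_unitVec_smul {n : ℕ} {x : Fin n → ℝ} (hx : x ≠ 0) :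
    ∃ c : ℝ, ∃ u : Fin n → ℝ, 0 < c ∧ unitVec u ∧ x = c • u := by
  have hpos : 0 < ∑ i, x i * x i := by
    obtain ⟨i, hi⟩ := Function.ne_iff.mp hx
    exact sum_pos' (fun j _ => mul_self_nonneg _) ⟨i, mem_univ i, mul_self_pos.mpr hi⟩
  have hc := Real.sqrt_pos.mpr hpos
  refine ⟨√(∑ i, x i * x i), (√(∑ i, x i * x i))⁻¹ • x, hc, ?_, ?_⟩
  · have hterm : ∀ i, ((√(∑ i, x i * x i))⁻¹ • x) i * ((√(∑ i, x i * x i))⁻¹ • x) i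
        = (∑ i, x i * x i)⁻¹ * (x i * x i) := fun i => by
      rw [Pi.smul_apply, smul_eq_mul, mul_mul_mul_comm, ← mul_inv, Real.mul_self_sqrt hpos.le]
    rw [unitVec, sum_congr rfl fun i _ => hterm i, ← mul_sum, inv_mul_cancel₀ hpos.ne']
  · rw [smul_inv_smul₀ hc.ne']

lemma tQuad_smul_smul {n : ℕ} (A : Fin n → Fin n → Fin n → Fin n → ℝ) (a b : ℝ)
    (x y : Fin n → ℝ) : tQuad A (a • x) (b • y) = a ^ 2 * b ^ 2 * tQuad A x y := by
  simp only [tQuad, mul_sum, Pi.smul_apply, smul_eq_mul]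
  exact sum_congr rfl fun i _ => sum_congr rfl fun j _ => sum_congr rfl fun k _ =>
    sum_congr rfl fun l _ => by ring

lemma tQuad_idT {n : ℕ} {x y : Fin n → ℝ} (hx : unitVec x) (hy : unitVec y) :
    tQuad (idT n) x y = 1 := by
  have h : tQuad (idT n) x y = (∑ i, x i * x i) * ∑ k, y k * y k := by
    simp [tQuad, idT, ite_and, sum_mul_sum, mul_assoc]
  rw [h, show ∑ i, x i * x i = 1 from hx, show ∑ i, y i * y i = 1 from hy, one_mul]

lemma tQuad_eq_sub {n : ℕ} {A B : Fin n → Fin n → Fin n → Fin n → ℝ} {s : ℝ}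
    (hAB : ∀ i j k l, A i j k l = s * idT n i j k l - B i j k l) {x y : Fin n → ℝ}
    (hx : unitVec x) (hy : unitVec y) : tQuad A x y = s - tQuad B x y := by
  rw [← mul_one s, ← tQuad_idT hx hy]
  simp only [tQuad, mul_sum, ← sum_sub_distrib, hAB]
  exact sum_congr rfl fun i _ => sum_congr rfl fun j _ => sum_congr rfl fun k _ =>
    sum_congr rfl fun l _ => by ring

/-- A nonsingular elasticity M-tensor satisfies the strong ellipticity condition. -/
lemma NonsingMT.mpd {n : ℕ} {A : Fin n → Fin n → Fin n → Fin n → ℝ} (h : NonsingMT A) :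
    MPD A := by
  obtain ⟨s, B, -, -, hAB, hs⟩ := h
  intro x y hx hy
  obtain ⟨a, u, ha, hu, rfl⟩ := exists_unitVec_smul hx
  obtain ⟨b, v, hb, hv, rfl⟩ := exists_unitVec_smul hy
  rw [tQuad_smul_smul, tQuad_eq_sub hAB hu hv]
  have := tQuad_le_rhoM B hu hv
  exact mul_pos (by positivity) (by linarith)

lemma tQuad_le_tQuad_abs {n : ℕ} {B : Fin n → Fin n → Fin n → Fin n → ℝ} (hB : NonnegT B)
    (x y : Fin n → ℝ) : tQuad B x y ≤ tQuad B (fun i => |x i|) (fun i => |y i|) := by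
  refine sum_le_sum fun i _ => sum_le_sum fun j _ => sum_le_sum fun k _ => sum_le_sum fun l _ => ?_
  refine (le_abs_self _).trans_eq ?_
  simp only [abs_mul, abs_of_nonneg (hB i j k l)]

lemma unitVec.abs {n : ℕ} {x : Fin n → ℝ} (hx : unitVec x) : unitVec fun i => |x i| := by
  simpa only [unitVec, abs_mul_abs_self] using hx

lemma exists_unitVec {n : ℕ} (hn : 1 ≤ n) : ∃ x : Fin n → ℝ, unitVec x :=
  ⟨Pi.single ⟨0, hn⟩ 1, by simp [unitVec, Pi.single_apply]⟩

/-- A Z-tensor which is positive on pairs of nonzero nonnegative vectors is a nonsingular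
M-tensor. -/
lemma nonsingMT_of_tQuad_pos {n : ℕ} (hn : 1 ≤ n) {A : Fin n → Fin n → Fin n → Fin n → ℝ}
    (hA : ElastSym A) (hZ : ZTensor A)
    (hpos : ∀ x y : Fin n → ℝ, x ≠ 0 → y ≠ 0 → (∀ i, 0 ≤ y i) → 0 < tQuad A x y) :
    NonsingMT A := by
  obtain ⟨e, he⟩ := exists_unitVec hn
  have hclosed : IsClosed {p : (Fin n → ℝ) × (Fin n → ℝ) | ∀ i, 0 ≤ p.2 i} := by
    simp only [Set.ofPred_forall]
    exact isClosed_iInter fun i => isClosed_le continuous_const (by fun_prop)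
  obtain ⟨⟨x₀, y₀⟩, ⟨⟨hx₀, hy₀⟩, hy₀'⟩, hmin⟩ :=
    (((isCompact_setOf_unitVec n).prod (isCompact_setOf_unitVec n)).inter_right
      hclosed).exists_isMinOn ⟨(e, fun i => |e i|), ⟨he, he.abs⟩, fun i => abs_nonneg (e i)⟩
      (continuous_tQuad A).continuousOn
  have hm := hpos x₀ y₀ (unitVec.ne_zero hx₀) (unitVec.ne_zero hy₀) hy₀'
  set s : ℝ := ∑ i, ∑ k, |A i i k k| with hs
  have hdiag : ∀ i k, A i i k k ≤ s := fun i k =>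
    (le_abs_self _).trans <|
      (single_le_sum (f := fun k => |A i i k k|) (fun _ _ => abs_nonneg _) (mem_univ k)).trans <|
        single_le_sum (f := fun i => ∑ k, |A i i k k|)
          (fun _ _ => sum_nonneg fun _ _ => abs_nonneg _) (mem_univ i)
  have hAB : ∀ i j k l, A i j k l = s * idT n i j k l - (s * idT n i j k l - A i j k l) :=
    fun i j k l => by ring
  have hB : NonnegT fun i j k l => s * idT n i j k l - A i j k l := by
    intro i j k l
    by_cases h : i = j ∧ k = l
    · obtain ⟨rfl, rfl⟩ := h
      simpa [idT] using hdiag i k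
    · simpa [idT, h] using hZ i j k l h
  refine ⟨s, fun i j k l => s * idT n i j k l - A i j k l, fun i j k l => ⟨?_, ?_⟩, hB, hAB, ?_⟩
  · simp only [idT, (hA i j k l).1, eq_comm (a := i)]
  · simp only [idT, (hA i j k l).2, eq_comm (a := k)]
  · refine lt_of_le_of_lt (csSup_le ⟨_, e, e, he, he, rfl⟩ ?_) (sub_lt_self s hm)
    rintro r ⟨x, y, hx, hy, rfl⟩
    refine (tQuad_le_tQuad_abs hB x y).trans ?_
    have h1 := tQuad_eq_sub hAB hx.abs hy.abs
    have h2 : tQuad A x₀ y₀ ≤ tQuad A (fun i => |x i|) fun i => |y i| :=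
      hmin (a := (fun i => |x i|, fun i => |y i|)) ⟨⟨hx.abs, hy.abs⟩, fun i => abs_nonneg (y i)⟩
    linarith

/-- characterizations of nonsingular elasticity M-tensors via `A y²` and
`A x y²`. -/
theorem stmt_18 {n : ℕ} (hn : 1 ≤ n) (A : Fin n → Fin n → Fin n → Fin n → ℝ)
    (hA : ElastSym A) (hZ : ZTensor A) :
    (NonsingMT A ↔ ∀ y : Fin n → ℝ, y ≠ 0 → (∀ i, 0 ≤ y i) → (matAy2 A y).PosDef) ∧
    (NonsingMT A ↔ ∀ y : Fin n → ℝ, y ≠ 0 → (∀ i, 0 ≤ y i) →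
        ∃ x : Fin n → ℝ, (∀ i, 0 < x i) ∧ ∀ i, 0 < tAxyy A x y i) ∧
    (NonsingMT A ↔ ∀ y : Fin n → ℝ, y ≠ 0 → (∀ i, 0 ≤ y i) →
        ∃ x : Fin n → ℝ, (∀ i, 0 ≤ x i) ∧ ∀ i, 0 < tAxyy A x y i) := by
  have h12 : NonsingMT A → ∀ y : Fin n → ℝ, y ≠ 0 → (∀ i, 0 ≤ y i) → (matAy2 A y).PosDef :=
    fun h y hy _ => PosDef.of_dotProduct_mulVec_pos (matAy2_isHermitian hA y) fun x hx => by
      rw [star_trivial, ← tQuad_eq_dotProduct]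
      exact h.mpd x y hx hy
  have h21 : (∀ y : Fin n → ℝ, y ≠ 0 → (∀ i, 0 ≤ y i) → (matAy2 A y).PosDef) → NonsingMT A :=
    fun h => nonsingMT_of_tQuad_pos hn hA hZ fun x y hx hy hy' => by
      simpa [tQuad_eq_dotProduct] using (h y hy hy').dotProduct_mulVec_pos hx
  have h13 : NonsingMT A → ∀ y : Fin n → ℝ, y ≠ 0 → (∀ i, 0 ≤ y i) →
      ∃ x : Fin n → ℝ, (∀ i, 0 < x i) ∧ ∀ i, 0 < tAxyy A x y i := fun h y hy hy' => by
    simpa only [tAxyy_eq_mulVec] using exists_pos_mulVec_pos_of_posDef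
      (fun i j hij => matAy2_apply_nonpos hZ hy' hij) (h12 h y hy hy')
  have h41 : (∀ y : Fin n → ℝ, y ≠ 0 → (∀ i, 0 ≤ y i) →
      ∃ x : Fin n → ℝ, (∀ i, 0 ≤ x i) ∧ ∀ i, 0 < tAxyy A x y i) → NonsingMT A :=
    fun h => h21 fun y hy hy' => by
      obtain ⟨x, hx, hMx⟩ := h y hy hy'
      rw [tAxyy_eq_mulVec] at hMx
      exact posDef_of_mulVec_pos (matAy2_isHermitian hA y)
        (fun i j hij => matAy2_apply_nonpos hZ hy' hij) hx hMx
  have h34 : ∀ y : Fin n → ℝ, (∃ x : Fin n → ℝ, (∀ i, 0 < x i) ∧ ∀ i, 0 < tAxyy A x y i) →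
      ∃ x : Fin n → ℝ, (∀ i, 0 ≤ x i) ∧ ∀ i, 0 < tAxyy A x y i :=
    fun y ⟨x, hx, hMx⟩ => ⟨x, fun i => (hx i).le, hMx⟩
  exact ⟨⟨h12, h21⟩, ⟨h13, fun h => h41 fun y hy hy' => h34 y (h y hy hy')⟩,
    ⟨fun h y hy hy' => h34 y (h13 h y hy hy'), h41⟩⟩
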